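/- If an extended word equation (U₁,U₂,<) is incoherent, then there is an incoherent core such that no cover in it impinges on another cover in it and every cover in it is twin-free. -/

import Mathlib

open scoped Classical

namespace ExtWordEq

/-- The type of (candidate) boundary orders: relations on pairs (i,j). -/
abbrev BRel : Type := ℕ × ℕ → ℕ × ℕ → Prop

variable {X : Type*}

/-- The `i`-th side of the word equation (`i = 1` gives `U₁`, anything else `U₂`). -/
def word (U₁ U₂ : List X) (i : ℕ) : List X := if i = 1 then U₁ else U₂

/-- The variable `U_{i,j}` (1-indexed), as an optional value. -/
def letter (U₁ U₂ : List X) (b : ℕ × ℕ) : Option X := (word U₁ U₂ b.1)[b.2 - 1]?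

/-- `b` is a boundary of the word equation `(U₁, U₂)`. -/
def Boundary (U₁ U₂ : List X) (b : ℕ × ℕ) : Prop :=
  (b.1 = 1 ∨ b.1 = 2) ∧ 1 ≤ b.2 ∧ b.2 ≤ (word U₁ U₂ b.1).length

/-- `b` is a boundary of `(U₁, U₂)` or one of the conventional boundaries `(1,0)`, `(2,0)`. -/
def EBoundary (U₁ U₂ : List X) (b : ℕ × ℕ) : Prop :=
  (b.1 = 1 ∨ b.1 = 2) ∧ b.2 ≤ (word U₁ U₂ b.1).length

/-- Incomparability `a ≈ b` for a strict order. -/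
def Incomp (lt : BRel) (a b : ℕ × ℕ) : Prop := ¬ lt a b ∧ ¬ lt b a

/-- `lt` is a boundary order for the word equation `(U₁, U₂)`:
a strict weak order on the boundaries (together with the conventional boundaries
`(1,0) ≈ (2,0)`), extending `(i,j) < (i,j+1)` and with `(1,m) ≈ (2,n)`. -/
structure BoundaryOrder (U₁ U₂ : List X) (lt : BRel) : Prop where
  irrefl : ∀ a, EBoundary U₁ U₂ a → ¬ lt a a
  trans : ∀ a b c, EBoundary U₁ U₂ a → EBoundary U₁ U₂ b → EBoundary U₁ U₂ c →
    lt a b → lt b c → lt a c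
  incomp_trans : ∀ a b c, EBoundary U₁ U₂ a → EBoundary U₁ U₂ b → EBoundary U₁ U₂ c →
    Incomp lt a b → Incomp lt b c → Incomp lt a c
  succ : ∀ i j : ℕ, EBoundary U₁ U₂ (i, j + 1) → lt (i, j) (i, j + 1)
  top : Incomp lt (1, U₁.length) (2, U₂.length)
  bot : Incomp lt (1, 0) (2, 0)

/-- `L(U_{i,1} U_{i,2} ⋯ U_{i,j})` where `L` is the additive extension of a length
assignment on variables. -/
def prefixLen (U₁ U₂ : List X) (L : X → ℕ) (b : ℕ × ℕ) : ℕ :=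
  (((word U₁ U₂ b.1).take b.2).map L).sum

/-- The extended word equation `(U₁, U₂, lt)` is coherent. -/
def Coherent (U₁ U₂ : List X) (lt : BRel) : Prop :=
  ∃ L : X → ℕ, (∀ x, 0 < L x) ∧
    ∀ a b, Boundary U₁ U₂ a → Boundary U₁ U₂ b →
      (lt a b ↔ prefixLen U₁ U₂ L a < prefixLen U₁ U₂ L b)

/-- The boundary `a` cuts the boundary `b`. -/
def Cuts (U₁ U₂ : List X) (lt : BRel) (a b : ℕ × ℕ) : Prop :=
  Boundary U₁ U₂ a ∧ Boundary U₁ U₂ b ∧ a ≠ b ∧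
    lt (a.1, a.2 - 1) b ∧ lt (b.1, b.2 - 1) a

/-- The boundary `a` mirrors the boundary `b`. -/
def Mirrors (U₁ U₂ : List X) (lt : BRel) (a b : ℕ × ℕ) : Prop :=
  Boundary U₁ U₂ a ∧ Boundary U₁ U₂ b ∧ letter U₁ U₂ a = letter U₁ U₂ b ∧
    (¬ Incomp lt a b ∨ ¬ Incomp lt (a.1, a.2 - 1) (b.1, b.2 - 1))

/-- Edge relation of the cut graph `G_{U₁,U₂,<}`. -/
def CutEdge (U₁ U₂ : List X) (lt : BRel) (a b : ℕ × ℕ) : Prop :=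
  ∃ c, Cuts U₁ U₂ lt a c ∧ Mirrors U₁ U₂ lt c b

/-- `w 0, w 1, …, w n` is a cycle (of length `n ≥ 1`) in the cut graph. -/
def IsCycle (U₁ U₂ : List X) (lt : BRel) (n : ℕ) (w : ℕ → ℕ × ℕ) : Prop :=
  0 < n ∧ w n = w 0 ∧ ∀ k < n, CutEdge U₁ U₂ lt (w k) (w (k + 1))

/-- The cut graph `G_{U₁,U₂,<}` is acyclic. -/
def Acyclic (U₁ U₂ : List X) (lt : BRel) : Prop :=
  ¬ ∃ n w, IsCycle U₁ U₂ lt n w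

variable [DecidableEq X]

/-- Case I extended Nielsen transformation (here `x = U_{1,1}`, `y = U_{2,1}`,
and `T(y) = x`). -/
def NielsenI (U₁ U₂ : List X) (lt : BRel) (U₁' U₂' : List X) (lt' : BRel) : Prop :=
  ∃ x y : X, U₁.head? = some x ∧ U₂.head? = some y ∧
    Incomp lt (1, 1) (2, 1) ∧
    U₁' = (U₁.map fun z => if z = y then x else z).tail ∧
    U₂' = (U₂.map fun z => if z = y then x else z).tail ∧
    BoundaryOrder U₁' U₂' lt' ∧
    ∀ a b : ℕ × ℕ, EBoundary U₁' U₂' a → EBoundary U₁' U₂' b →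
      (lt' a b ↔ lt (a.1, a.2 + 1) (b.1, b.2 + 1))

/-- The substitution `T(x) = y x` (identity on other variables), applied to a word. -/
def expand (x y : X) (l : List X) : List X :=
  l.flatMap fun z => if z = x then [y, x] else [z]

/-- The map `μ(i,j) = j + #{j' ≤ j : U_{i,j'} = x} − 1` (as a map on boundaries),
where `x = U_{1,1}`. -/
def mu (U₁ U₂ : List X) (x : X) (b : ℕ × ℕ) : ℕ × ℕ :=
  (b.1, b.2 + ((word U₁ U₂ b.1).take b.2).count x - 1)

/-- The map `ν(i,j) = j − #{j' ≤ j : U'_{i,j'} = x} + 1` (as a map on boundaries),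
where `x = U_{1,1}`. -/
def nu (U₁' U₂' : List X) (x : X) (b : ℕ × ℕ) : ℕ × ℕ :=
  (b.1, b.2 - ((word U₁' U₂' b.1).take b.2).count x + 1)

/-- Membership in `B⁻ = B ∖ {(2,1)}`. -/
def Bminus (U₁ U₂ : List X) (b : ℕ × ℕ) : Prop := Boundary U₁ U₂ b ∧ b ≠ (2, 1)

/-- Membership in `B'⁻ = {(i, μ(i,j)) : (i,j) ∈ B⁻}` (`x = U_{1,1}`). -/
def Bpminus (U₁ U₂ : List X) (x : X) (b' : ℕ × ℕ) : Prop :=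
  ∃ b, Bminus U₁ U₂ b ∧ mu U₁ U₂ x b = b'

/-- Case II extended Nielsen transformation, with the heads `x = U_{1,1}`,
`y = U_{2,1}` made explicit. -/
def NielsenIIxy (U₁ U₂ : List X) (lt : BRel) (U₁' U₂' : List X) (lt' : BRel)
    (x y : X) : Prop :=
  U₁.head? = some x ∧ U₂.head? = some y ∧
  lt (2, 1) (1, 1) ∧
  U₁' = (expand x y U₁).tail ∧
  U₂' = (expand x y U₂).tail ∧
  BoundaryOrder U₁' U₂' lt' ∧
  ∀ a b, Bpminus U₁ U₂ x a → Bpminus U₁ U₂ x b →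
    (lt' a b ↔ lt (nu U₁' U₂' x a) (nu U₁' U₂' x b))

/-- Case II extended Nielsen transformation. -/
def NielsenII (U₁ U₂ : List X) (lt : BRel) (U₁' U₂' : List X) (lt' : BRel) : Prop :=
  ∃ x y : X, NielsenIIxy U₁ U₂ lt U₁' U₂' lt' x y

/-- The dual boundary order. -/
def dualRel (lt : BRel) : BRel := fun a b => lt (3 - a.1, a.2) (3 - b.1, b.2)

/-- Case III extended Nielsen transformation: case II applied to the dual,
then dualized back. -/
def NielsenIII (U₁ U₂ : List X) (lt : BRel) (U₁' U₂' : List X) (lt' : BRel) : Prop :=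
  NielsenII U₂ U₁ (dualRel lt) U₂' U₁' (dualRel lt')

/-- `(U₁', U₂', lt')` is an extended Nielsen transformation of the nontrivial coherent
extended word equation `(U₁, U₂, lt)`. -/
def ExtNielsen (U₁ U₂ : List X) (lt : BRel) (U₁' U₂' : List X) (lt' : BRel) : Prop :=
  U₁ ≠ [] ∧ U₂ ≠ [] ∧ BoundaryOrder U₁ U₂ lt ∧ Coherent U₁ U₂ lt ∧
    (NielsenI U₁ U₂ lt U₁' U₂' lt' ∨ NielsenII U₁ U₂ lt U₁' U₂' lt' ∨
      NielsenIII U₁ U₂ lt U₁' U₂' lt')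

/-- A coherent extended Nielsen transformation. -/
def CohNielsen (U₁ U₂ : List X) (lt : BRel) (U₁' U₂' : List X) (lt' : BRel) : Prop :=
  ExtNielsen U₁ U₂ lt U₁' U₂' lt' ∧ Coherent U₁' U₂' lt'

/-- `(U₁, U₂, lt)` is (strongly) terminating: there is no infinite sequence of coherent
extended Nielsen transformations starting from it. -/
def Terminating (U₁ U₂ : List X) (lt : BRel) : Prop :=
  ¬ ∃ f : ℕ → List X × List X × BRel,
    f 0 = (U₁, U₂, lt) ∧
    ∀ n, CohNielsen (f n).1 (f n).2.1 (f n).2.2 (f (n + 1)).1 (f (n + 1)).2.1 (f (n + 1)).2.2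


/-- An interval of boundaries `⟨i,[j,k]⟩ = {(i,ℓ) : j ≤ ℓ ≤ k}`. -/
structure Seg where
  i : ℕ
  j : ℕ
  k : ℕ
deriving DecidableEq

/-- `s` is a valid (possibly empty) interval of boundaries of `(U₁,U₂)`. -/
def ValidSeg (U₁ U₂ : List X) (s : Seg) : Prop :=
  (s.i = 1 ∨ s.i = 2) ∧ 1 ≤ s.j ∧ s.j ≤ s.k + 1 ∧ s.k ≤ (word U₁ U₂ s.i).length

/-- `a ≲ b`, i.e. `a < b` or `a ≈ b`. -/
def LeS (lt : BRel) (a b : ℕ × ℕ) : Prop := lt a b ∨ Incomp lt a b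

/-- `(A, B)` is a cover: `A` and `B` are intervals on opposite sides with
`(B.i, B.j−1) ≲ (A.i, A.j−1)` and `(A.i, A.k) ≲ (B.i, B.k)`. -/
def IsCover (U₁ U₂ : List X) (lt : BRel) (A B : Seg) : Prop :=
  ValidSeg U₁ U₂ A ∧ ValidSeg U₁ U₂ B ∧ A.i ≠ B.i ∧
    LeS lt (B.i, B.j - 1) (A.i, A.j - 1) ∧ LeS lt (A.i, A.k) (B.i, B.k)

/-- `(A, B)` is a strict cover: a cover for which at least one of the two defining
inequalities is strict. -/
def IsStrictCover (U₁ U₂ : List X) (lt : BRel) (A B : Seg) : Prop :=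
  IsCover U₁ U₂ lt A B ∧ (lt (B.i, B.j - 1) (A.i, A.j - 1) ∨ lt (A.i, A.k) (B.i, B.k))

/-- The list of variables `U_{i,j} U_{i,j+1} ⋯ U_{i,k}` of the interval `s`. -/
def segList (U₁ U₂ : List X) (s : Seg) : List X :=
  ((word U₁ U₂ s.i).take s.k).drop (s.j - 1)

/-- `L(U_{⟨i,[j,k]⟩})`, the value of the additive extension of `L` on an interval. -/
def segL (U₁ U₂ : List X) (L : X → ℕ) (s : Seg) : ℕ := ((segList U₁ U₂ s).map L).sum

/-- `U_{⟨i,[j,k]⟩} = Σ_{ℓ=j}^{k} U_{i,ℓ}` as an element of `ℕ[𝒳]`,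
the free commutative monoid on `X` (realized as `X →₀ ℕ`). -/
noncomputable def segSum (U₁ U₂ : List X) (s : Seg) : X →₀ ℕ :=
  ((segList U₁ U₂ s).map fun a => Finsupp.single a 1).sum

/-- A set `C` of covers is an incoherent core: the associated system of inequalities
(non-strict for covers, strict for strict covers) has no solution over `ℤ_{>0}`. -/
def IncoherentCore (U₁ U₂ : List X) (lt : BRel) (C : Set (Seg × Seg)) : Prop :=
  (∀ p ∈ C, IsCover U₁ U₂ lt p.1 p.2) ∧
  ¬ ∃ L : X → ℕ, (∀ x, 0 < L x) ∧
    (∀ p ∈ C, segL U₁ U₂ L p.1 ≤ segL U₁ U₂ L p.2) ∧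
    (∀ p ∈ C, IsStrictCover U₁ U₂ lt p.1 p.2 → segL U₁ U₂ L p.1 < segL U₁ U₂ L p.2)

/-- The boundary `b` lies in the interval `s`. -/
def InSeg (s : Seg) (b : ℕ × ℕ) : Prop := b.1 = s.i ∧ s.j ≤ b.2 ∧ b.2 ≤ s.k

/-- The cover `p` impinges on the cover `q`: `B₁ ∩ A₂ ≠ ∅`. -/
def Impinges (p q : Seg × Seg) : Prop := ∃ b, InSeg p.2 b ∧ InSeg q.1 b

/-- Boundaries `a` and `b` are twins. -/
def Twins (U₁ U₂ : List X) (lt : BRel) (a b : ℕ × ℕ) : Prop :=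
  Boundary U₁ U₂ a ∧ Boundary U₁ U₂ b ∧ letter U₁ U₂ a = letter U₁ U₂ b ∧
    a ≠ b ∧ Incomp lt a b ∧ Incomp lt (a.1, a.2 - 1) (b.1, b.2 - 1)

/-- The cover `p` is twin-free: neither of its intervals contains a twin. -/
def TwinFree (U₁ U₂ : List X) (lt : BRel) (p : Seg × Seg) : Prop :=
  (∀ a, InSeg p.1 a → ¬ ∃ b, Twins U₁ U₂ lt a b) ∧
  (∀ a, InSeg p.2 a → ¬ ∃ b, Twins U₁ U₂ lt a b)

theorem exists_between_of_finite {A B : Set ℚ} (hA : A.Finite) (hB : B.Finite)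
    (h : ∀ a ∈ A, ∀ b ∈ B, a ≤ b) : ∃ t, (∀ a ∈ A, a ≤ t) ∧ ∀ b ∈ B, t ≤ b := by
  rcases A.eq_empty_or_nonempty with rfl | hne
  · obtain ⟨t, ht⟩ := hB.bddBelow
    exact ⟨t, by simp, fun b hb => ht hb⟩
  · obtain ⟨t, ht, hmax⟩ := Set.exists_max_image A id hA hne
    exact ⟨t, hmax, h t ht⟩

theorem nsmul_add_nsmul_fst {X : Type*} (u v : ℕ) (p q : (X → ℤ) × ℤ) (x : X) :
    (u • p + v • q).1 x = u * p.1 x + v * q.1 x := by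
  simp only [Prod.fst_add, Prod.smul_fst, Pi.add_apply, Pi.smul_apply]
  simp only [nsmul_eq_mul]

theorem nsmul_add_nsmul_snd {X : Type*} (u v : ℕ) (p q : (X → ℤ) × ℤ) :
    (u • p + v • q).2 = u * p.2 + v * q.2 := by
  simp only [Prod.snd_add, Prod.smul_snd]
  simp only [nsmul_eq_mul]

/-- Affine Farkas lemma, proved by Fourier–Motzkin elimination: a finite system of inequalities
`g.2 ≤ ∑ x ∈ s, g.1 x * L x` is solvable over `ℚ`, unless some sum of them reads `t ≤ 0`
with `0 < t`. -/
theorem exists_solution_or_refutation {X : Type*} (s : Finset X) :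
    ∀ G : Set ((X → ℤ) × ℤ), G.Finite →
      (∃ L : X → ℚ, ∀ g ∈ G, (g.2 : ℚ) ≤ ∑ x ∈ s, g.1 x * L x) ∨
      ∃ g ∈ AddSubmonoid.closure G, (∀ x ∈ s, g.1 x = 0) ∧ 0 < g.2 := by
  induction s using Finset.induction_on with
  | empty =>
    intro G _
    by_cases h : ∃ g ∈ G, 0 < g.2
    · obtain ⟨g, hg, h0⟩ := h
      exact Or.inr ⟨g, AddSubmonoid.subset_closure hg, by simp, h0⟩
    · push Not at h
      exact Or.inl ⟨0, fun g hg => by simpa using h g hg⟩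
  | insert a s ha ih =>
    intro G hG
    set G' : Set ((X → ℤ) × ℤ) := {g ∈ G | g.1 a = 0} ∪
      Set.image2 (fun p n => (-n.1 a).toNat • p + (p.1 a).toNat • n)
        {p ∈ G | 0 < p.1 a} {n ∈ G | n.1 a < 0} with hG'
    have hfin : G'.Finite := (hG.subset (Set.sep_subset _ _)).union
      ((hG.subset (Set.sep_subset _ _)).image2 _ (hG.subset (Set.sep_subset _ _)))
    rcases ih G' hfin with ⟨L, hL⟩ | ⟨g, hg, h0, hpos⟩
    · left
      set b : (X → ℤ) × ℤ → ℚ := fun g => (g.2 - ∑ x ∈ s, g.1 x * L x) / g.1 a with hb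
      obtain ⟨t, hlo, hhi⟩ := exists_between_of_finite
        (A := b '' {p ∈ G | 0 < p.1 a}) (B := b '' {n ∈ G | n.1 a < 0})
        ((hG.subset (Set.sep_subset _ _)).image _) ((hG.subset (Set.sep_subset _ _)).image _)
        (by
          rintro _ ⟨p, ⟨hp, hp0⟩, rfl⟩ _ ⟨n, ⟨hn, hn0⟩, rfl⟩
          have h := hL _ (Or.inr ⟨p, ⟨hp, hp0⟩, n, ⟨hn, hn0⟩, rfl⟩)
          have e1 : (((-n.1 a).toNat : ℕ) : ℚ) = -(n.1 a : ℚ) := by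
            exact_mod_cast Int.toNat_of_nonneg (by omega : 0 ≤ -n.1 a)
          have e2 : (((p.1 a).toNat : ℕ) : ℚ) = (p.1 a : ℚ) := by
            exact_mod_cast Int.toNat_of_nonneg hp0.le
          have e3 : ∑ x ∈ s, ((((-n.1 a).toNat • p + (p.1 a).toNat • n).1 x : ℤ) : ℚ) * L x =
              -(n.1 a : ℚ) * ∑ x ∈ s, p.1 x * L x + (p.1 a : ℚ) * ∑ x ∈ s, n.1 x * L x := by
            rw [Finset.mul_sum, Finset.mul_sum, ← Finset.sum_add_distrib]
            refine Finset.sum_congr rfl fun x _ => ?_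
            rw [nsmul_add_nsmul_fst, Int.cast_add, Int.cast_mul, Int.cast_mul, Int.cast_natCast,
              Int.cast_natCast, e1, e2]
            ring
          have e4 : ((((-n.1 a).toNat • p + (p.1 a).toNat • n).2 : ℤ) : ℚ) =
              -(n.1 a : ℚ) * p.2 + (p.1 a : ℚ) * n.2 := by
            rw [nsmul_add_nsmul_snd, Int.cast_add, Int.cast_mul, Int.cast_mul, Int.cast_natCast,
              Int.cast_natCast, e1, e2]
          simp only [e3, e4] at h
          have hp0' : (0 : ℚ) < p.1 a := by exact_mod_cast hp0
          have hn0' : (n.1 a : ℚ) < 0 := by exact_mod_cast hn0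
          simp only [hb]
          rw [div_le_iff₀ hp0', div_mul_eq_mul_div, le_div_iff_of_neg hn0']
          linarith)
      refine ⟨Function.update L a t, fun g hg => ?_⟩
      have hs : ∑ x ∈ s, (g.1 x : ℚ) * Function.update L a t x = ∑ x ∈ s, (g.1 x : ℚ) * L x :=
        Finset.sum_congr rfl fun x hx => by
          rw [Function.update_of_ne (by rintro rfl; exact ha hx)]
      rw [Finset.sum_insert ha, hs, Function.update_self]
      rcases lt_trichotomy (g.1 a) 0 with h | h | h
      · have := hhi _ ⟨g, ⟨hg, h⟩, rfl⟩
        have h' : (g.1 a : ℚ) < 0 := by exact_mod_cast h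
        simp only [hb] at this
        rw [le_div_iff_of_neg h'] at this
        linarith
      · have := hL g (Or.inl ⟨hg, h⟩)
        simpa [h] using this
      · have := hlo _ ⟨g, ⟨hg, h⟩, rfl⟩
        have h' : (0 : ℚ) < g.1 a := by exact_mod_cast h
        simp only [hb] at this
        rw [div_le_iff₀ h'] at this
        linarith
    · right
      have hle : G' ⊆ AddSubmonoid.closure G := by
        rintro _ (⟨hg, _⟩ | ⟨p, ⟨hp, _⟩, n, ⟨hn, _⟩, rfl⟩)
        · exact AddSubmonoid.subset_closure hg
        · exact add_mem (nsmul_mem (AddSubmonoid.subset_closure hp) _)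
            (nsmul_mem (AddSubmonoid.subset_closure hn) _)
      have hzero : ∀ g ∈ AddSubmonoid.closure G', g.1 a = 0 := by
        intro g hg
        induction hg using AddSubmonoid.closure_induction with
        | mem g hg =>
          rcases hg with ⟨_, h⟩ | ⟨p, ⟨_, hp⟩, n, ⟨_, hn⟩, rfl⟩
          · exact h
          · rw [nsmul_add_nsmul_fst, Int.toNat_of_nonneg hp.le,
              Int.toNat_of_nonneg (neg_nonneg.2 hn.le)]
            ring
        | zero => rfl
        | add x y _ _ hx hy => rw [Prod.fst_add, Pi.add_apply, hx, hy, add_zero]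
      exact ⟨g, AddSubmonoid.closure_le.2 hle hg, by simpa [hzero g hg] using h0, hpos⟩

/-- An integral version of `exists_solution_or_refutation`. -/
theorem exists_int_solution_or_refutation {X : Type*} (s : Finset X) (G : Set ((X → ℤ) × ℤ))
    (hG : G.Finite) (hnn : ∀ g ∈ G, 0 ≤ g.2) :
    (∃ L : X → ℤ, ∀ g ∈ G, g.2 ≤ ∑ x ∈ s, g.1 x * L x) ∨
      ∃ g ∈ AddSubmonoid.closure G, (∀ x ∈ s, g.1 x = 0) ∧ 0 < g.2 := by
  refine (exists_solution_or_refutation s G hG).imp_left ?_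
  rintro ⟨L, hL⟩
  obtain ⟨⟨d, hd⟩, hint⟩ := IsLocalization.exist_integer_multiples_of_finset
    (nonZeroDivisors ℤ) (s.image L)
  have hd0 : d ≠ 0 := nonZeroDivisors.ne_zero hd
  choose! z hz using fun x (hx : x ∈ s) => hint (L x) (Finset.mem_image_of_mem L hx)
  refine ⟨fun x => d * z x, fun g hg => ?_⟩
  have hsum : ∑ x ∈ s, (g.1 x : ℚ) * ((d * z x : ℤ) : ℚ) = d * d * ∑ x ∈ s, g.1 x * L x := by
    rw [Finset.mul_sum]
    refine Finset.sum_congr rfl fun x hx => ?_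
    have h : (z x : ℚ) = d * L x := by simpa [Algebra.smul_def] using hz x hx
    rw [Int.cast_mul, h]
    ring
  have hdd : (1 : ℚ) ≤ d * d := by exact_mod_cast (mul_self_pos.2 hd0 : 0 < d * d)
  have hg0 : (0 : ℚ) ≤ g.2 := by exact_mod_cast hnn g hg
  have hLg := hL g hg
  have : (g.2 : ℚ) ≤ ∑ x ∈ s, (g.1 x : ℚ) * ((d * z x : ℤ) : ℚ) := by
    rw [hsum]
    nlinarith
  exact_mod_cast this

/-- For `P i j` the position of the boundary `(i, j)`, the amount by which the second interval
of `p` is longer than the first. -/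
def excess (P : ℕ → ℕ → ℤ) (p : Seg × Seg) : ℤ :=
  P p.2.i p.2.k - P p.2.i (p.2.j - 1) - (P p.1.i p.1.k - P p.1.i (p.1.j - 1))

/-- The number of boundaries in the two intervals of `p`. -/
def weight (p : Seg × Seg) : ℕ := (p.1.k + 1 - p.1.j) + (p.2.k + 1 - p.2.j)

/-- `p` is a cover for the boundary order in which the boundary `(i, j)` has rank `r i j`, where
side `i` has `n i` boundaries. -/
structure RankCover (n : ℕ → ℕ) (r : ℕ → ℕ → ℤ) (p : Seg × Seg) : Prop where
  side : p.1.i = 1 ∧ p.2.i = 2 ∨ p.1.i = 2 ∧ p.2.i = 1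
  fst_pos : 1 ≤ p.1.j
  fst_le : p.1.j ≤ p.1.k + 1
  fst_bound : p.1.k ≤ n p.1.i
  snd_pos : 1 ≤ p.2.j
  snd_le : p.2.j ≤ p.2.k + 1
  snd_bound : p.2.k ≤ n p.2.i
  left : r p.2.i (p.2.j - 1) ≤ r p.1.i (p.1.j - 1)
  right : r p.1.i p.1.k ≤ r p.2.i p.2.k

/-- A multiset of covers whose inequalities sum up to a contradiction for all position functions
in `V`. -/
structure Certificate (n : ℕ → ℕ) (r : ℕ → ℕ → ℤ) (V : Set (ℕ → ℕ → ℤ))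
    (m : Multiset (Seg × Seg)) : Prop where
  cover : ∀ p ∈ m, RankCover n r p
  nonpos : ∀ P ∈ V, (m.map (excess P)).sum ≤ 0
  strict : ∀ P ∈ V, 0 < (m.map (excess r)).sum ∨ (m.map (excess P)).sum < 0

/-- `m` can be replaced by `m'` in certificates, and this decreases the weight. -/
structure Reduces (n : ℕ → ℕ) (r : ℕ → ℕ → ℤ) (V : Set (ℕ → ℕ → ℤ))
    (m m' : Multiset (Seg × Seg)) : Prop where
  cover : ∀ p ∈ m', RankCover n r p
  weight_lt : (m'.map weight).sum < (m.map weight).sum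
  excess_le : ∀ P ∈ V, (m'.map (excess P)).sum ≤ (m.map (excess P)).sum
  strict : ∀ P ∈ V, (m.map (excess r)).sum ≤ (m'.map (excess r)).sum ∨
    (m'.map (excess P)).sum < (m.map (excess P)).sum

theorem Certificate.reduce {n : ℕ → ℕ} {r : ℕ → ℕ → ℤ} {V : Set (ℕ → ℕ → ℤ)}
    {m m' c : Multiset (Seg × Seg)} (h : Certificate n r V (m + c)) (hr : Reduces n r V m m') :
    Certificate n r V (m' + c) := by
  refine ⟨fun p hp => ?_, fun P hP => ?_, fun P hP => ?_⟩
  · rcases Multiset.mem_add.1 hp with hp | hp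
    · exact hr.cover p hp
    · exact h.cover p (Multiset.mem_add.2 (Or.inr hp))
  · have h1 := h.nonpos P hP
    have h2 := hr.excess_le P hP
    simp only [Multiset.map_add, Multiset.sum_add] at h1 ⊢
    omega
  · have h1 := h.nonpos P hP
    have h2 := hr.excess_le P hP
    have h3 := h.strict P hP
    have h4 := hr.strict P hP
    simp only [Multiset.map_add, Multiset.sum_add] at h1 h3 ⊢
    omega

section Reductions

variable {n : ℕ → ℕ} {r : ℕ → ℕ → ℤ} {V : Set (ℕ → ℕ → ℤ)}

/-- Uncrossing on one end: the two intervals between `a`, `b'` on side `i` and between `a'`, `b` on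
side `i'` form at most one cover, up to dropping intervals that count positively. -/
theorem exists_uncrossing_end (hr : ∀ i, StrictMonoOn (r i) (Set.Iic (n i)))
    (hV : ∀ P ∈ V, ∀ i, StrictMonoOn (P i) (Set.Iic (n i))) {i i' a a' b b' : ℕ}
    (hi : i = 1 ∧ i' = 2 ∨ i = 2 ∧ i' = 1) (ha : a ≤ n i) (hb' : b' ≤ n i) (ha' : a' ≤ n i')
    (hb : b ≤ n i') (h : r i' b ≤ r i a) (h' : r i b' ≤ r i' a') :
    ∃ m : Multiset (Seg × Seg), (∀ p ∈ m, RankCover n r p) ∧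
      (m.map weight).sum ≤ (a' - b) + (b - a') + (a - b') + (b' - a) ∧
      ∀ P ∈ V, (m.map (excess P)).sum ≤ P i' a' - P i' b + P i a - P i b' ∧
        (r i' a' - r i' b + r i a - r i b' ≤ (m.map (excess r)).sum ∨
          (m.map (excess P)).sum < P i' a' - P i' b + P i a - P i b') := by
  have r1 := (hr i).lt_iff_lt ha hb'
  have r2 := (hr i').lt_iff_lt ha' hb
  have r3 := (hr i).le_iff_le ha hb'
  have r4 := (hr i').le_iff_le ha' hb
  by_cases h1 : a < b'
  · refine ⟨{(⟨i, a + 1, b'⟩, ⟨i', b + 1, a'⟩)}, ?_, ?_, fun P hP => ?_⟩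
    · intro p hp
      rw [Multiset.mem_singleton] at hp
      subst hp
      constructor <;> simp only [Nat.add_sub_cancel] <;> omega
    · simp only [Multiset.map_singleton, Multiset.sum_singleton, weight]
      omega
    · simp only [Multiset.map_singleton, Multiset.sum_singleton, excess, Nat.add_sub_cancel]
      omega
  by_cases h2 : a' < b
  · refine ⟨{(⟨i', a' + 1, b⟩, ⟨i, b' + 1, a⟩)}, ?_, ?_, fun P hP => ?_⟩
    · intro p hp
      rw [Multiset.mem_singleton] at hp
      subst hp
      constructor <;> simp only [Nat.add_sub_cancel] <;> omega
    · simp only [Multiset.map_singleton, Multiset.sum_singleton, weight]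
      omega
    · simp only [Multiset.map_singleton, Multiset.sum_singleton, excess, Nat.add_sub_cancel]
      omega
  · refine ⟨0, by simp, by simp, fun P hP => ?_⟩
    have p1 := (hV P hP i).lt_iff_lt hb' ha
    have p2 := (hV P hP i').lt_iff_lt hb ha'
    have p3 := (hV P hP i).le_iff_le hb' ha
    have p4 := (hV P hP i').le_iff_le hb ha'
    simp only [Multiset.map_zero, Multiset.sum_zero]
    omega

/-- A cover impinging on another cover can be uncrossed. -/
theorem exists_reduces_of_impinges (hr : ∀ i, StrictMonoOn (r i) (Set.Iic (n i)))
    (hV : ∀ P ∈ V, ∀ i, StrictMonoOn (P i) (Set.Iic (n i))) {p q : Seg × Seg}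
    (hp : RankCover n r p) (hq : RankCover n r q) (h : Impinges p q) :
    ∃ m, Reduces n r V {p, q} m := by
  obtain ⟨⟨t, u⟩, ⟨ht, hu1, hu2⟩, ht', hu3, hu4⟩ := h
  obtain ⟨⟨i, a, x⟩, ⟨i', b, y⟩⟩ := p
  obtain ⟨⟨s, a', x'⟩, ⟨s', b', y'⟩⟩ := q
  obtain ⟨p1, p2, p3, p4, p5, p6, p7, p8, p9⟩ := hp
  obtain ⟨q1, q2, q3, q4, q5, q6, q7, q8, q9⟩ := hq
  dsimp only at *
  obtain ⟨a, rfl⟩ := Nat.exists_eq_add_of_le' p2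
  obtain ⟨b, rfl⟩ := Nat.exists_eq_add_of_le' p5
  obtain ⟨a', rfl⟩ := Nat.exists_eq_add_of_le' q2
  obtain ⟨b', rfl⟩ := Nat.exists_eq_add_of_le' q5
  obtain rfl : i' = s := by omega
  obtain rfl : i = s' := by omega
  simp only [Nat.add_sub_cancel] at p8 q8
  have rxb := (hr i).le_iff_le (show x ≤ n i by omega) (show b' ≤ n i by omega)
  have rya := (hr i).le_iff_le (show y' ≤ n i by omega) (show a ≤ n i by omega)
  have rax := (hr i).le_iff_le (show a ≤ n i by omega) (show x ≤ n i by omega)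
  have rby := (hr i).lt_iff_lt (show b' ≤ n i by omega) (show y' ≤ n i by omega)
  have rby' := (hr i').lt_iff_lt (show b ≤ n i' by omega) (show y ≤ n i' by omega)
  have rax' := (hr i').lt_iff_lt (show a' ≤ n i' by omega) (show x' ≤ n i' by omega)
  have rba' := (hr i').le_iff_le (show b ≤ n i' by omega) (show a' ≤ n i' by omega)
  have rxy' := (hr i').le_iff_le (show x' ≤ n i' by omega) (show y ≤ n i' by omega)
  have ray' := (hr i').lt_iff_lt (show a' ≤ n i' by omega) (show y ≤ n i' by omega)
  have rbx' := (hr i').lt_iff_lt (show b ≤ n i' by omega) (show x' ≤ n i' by omega)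
  by_cases hdl : x ≤ b'
  · by_cases hc : y < x'
    · refine ⟨{(⟨i, a + 1, x⟩, ⟨i', b + 1, a'⟩), (⟨i', y + 1, x'⟩, ⟨i, b' + 1, y'⟩)}, ?_, ?_, fun P hP => ?_, fun P hP => ?_⟩
      · intro p hp
        simp only [Multiset.insert_eq_cons, Multiset.mem_cons, Multiset.mem_singleton] at hp
        rcases hp with rfl | rfl <;> constructor <;> simp only [Nat.add_sub_cancel] <;> omega
      all_goals
        simp only [Multiset.insert_eq_cons, Multiset.map_cons, Multiset.sum_cons,
          Multiset.map_singleton, Multiset.sum_singleton, weight, excess, Nat.add_sub_cancel]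
        omega
    · refine ⟨{(⟨i, a + 1, x⟩, ⟨i', b + 1, a'⟩)}, ?_, ?_, fun P hP => ?_, fun P hP => ?_⟩
      · intro p hp
        rw [Multiset.mem_singleton] at hp
        subst hp
        constructor <;> simp only [Nat.add_sub_cancel] <;> omega
      · simp only [Multiset.insert_eq_cons, Multiset.map_cons, Multiset.sum_cons,
          Multiset.map_singleton, Multiset.sum_singleton, weight]
        omega
      all_goals
        have p1 := (hV P hP i).lt_iff_lt (show b' ≤ n i by omega) (show y' ≤ n i by omega)
        have p2 := (hV P hP i').le_iff_le (show x' ≤ n i' by omega) (show y ≤ n i' by omega)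
        simp only [Multiset.insert_eq_cons, Multiset.map_cons, Multiset.sum_cons,
          Multiset.map_singleton, Multiset.sum_singleton, excess, Nat.add_sub_cancel]
        omega
  by_cases hdr : y' ≤ a
  · by_cases hc : a' < b
    · refine ⟨{(⟨i, a + 1, x⟩, ⟨i', x' + 1, y⟩), (⟨i', a' + 1, b⟩, ⟨i, b' + 1, y'⟩)}, ?_, ?_, fun P hP => ?_, fun P hP => ?_⟩
      · intro p hp
        simp only [Multiset.insert_eq_cons, Multiset.mem_cons, Multiset.mem_singleton] at hp
        rcases hp with rfl | rfl <;> constructor <;> simp only [Nat.add_sub_cancel] <;> omega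
      all_goals
        simp only [Multiset.insert_eq_cons, Multiset.map_cons, Multiset.sum_cons,
          Multiset.map_singleton, Multiset.sum_singleton, weight, excess, Nat.add_sub_cancel]
        omega
    · refine ⟨{(⟨i, a + 1, x⟩, ⟨i', x' + 1, y⟩)}, ?_, ?_, fun P hP => ?_, fun P hP => ?_⟩
      · intro p hp
        rw [Multiset.mem_singleton] at hp
        subst hp
        constructor <;> simp only [Nat.add_sub_cancel] <;> omega
      · simp only [Multiset.insert_eq_cons, Multiset.map_cons, Multiset.sum_cons,
          Multiset.map_singleton, Multiset.sum_singleton, weight]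
        omega
      all_goals
        have p1 := (hV P hP i).lt_iff_lt (show b' ≤ n i by omega) (show y' ≤ n i by omega)
        have p2 := (hV P hP i').le_iff_le (show b ≤ n i' by omega) (show a' ≤ n i' by omega)
        simp only [Multiset.insert_eq_cons, Multiset.map_cons, Multiset.sum_cons,
          Multiset.map_singleton, Multiset.sum_singleton, excess, Nat.add_sub_cancel]
        omega
  obtain ⟨m₁, c₁, w₁, e₁⟩ := exists_uncrossing_end (V := V) hr hV (i := i) (i' := i') (a := a)
    (a' := a') (b := b) (b' := b') p1 (by omega) (by omega) (by omega) (by omega) p8 q8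
  obtain ⟨m₂, c₂, w₂, e₂⟩ := exists_uncrossing_end (V := V) hr hV (i := i) (i' := i') (a := y')
    (a' := y) (b := x') (b' := x) p1 (by omega) (by omega) (by omega) (by omega) q9 p9
  refine ⟨m₁ + m₂, ?_, ?_, fun P hP => ?_, fun P hP => ?_⟩
  · intro p hp
    exact (Multiset.mem_add.1 hp).elim (c₁ p) (c₂ p)
  · simp only [Multiset.map_add, Multiset.sum_add, Multiset.insert_eq_cons, Multiset.map_cons,
      Multiset.sum_cons, Multiset.map_singleton, Multiset.sum_singleton, weight]
    omega
  · have h₁ := e₁ P hP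
    have h₂ := e₂ P hP
    simp only [Multiset.map_add, Multiset.sum_add, Multiset.insert_eq_cons, Multiset.map_cons,
      Multiset.sum_cons, Multiset.map_singleton, Multiset.sum_singleton, excess,
      Nat.add_sub_cancel] at h₁ h₂ ⊢
    omega
  · have h₁ := e₁ P hP
    have h₂ := e₂ P hP
    simp only [Multiset.map_add, Multiset.sum_add, Multiset.insert_eq_cons, Multiset.map_cons,
      Multiset.sum_cons, Multiset.map_singleton, Multiset.sum_singleton, excess,
      Nat.add_sub_cancel] at h₁ h₂ ⊢
    omega

/-- A pair of twins `(p.1.i, u)` and `(p.2.i, v)` can be removed from the cover `p`. -/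
theorem exists_reduces_of_twin (hr : ∀ i, StrictMonoOn (r i) (Set.Iic (n i)))
    (hV : ∀ P ∈ V, ∀ i, StrictMonoOn (P i) (Set.Iic (n i))) {p : Seg × Seg}
    (hp : RankCover n r p) {u v : ℕ} (hu : 1 ≤ u) (hun : u ≤ n p.1.i) (hv : 1 ≤ v)
    (hvn : v ≤ n p.2.i) (hpred : r p.1.i (u - 1) = r p.2.i (v - 1)) (heq : r p.1.i u = r p.2.i v)
    (hP : ∀ P ∈ V, P p.1.i u - P p.1.i (u - 1) = P p.2.i v - P p.2.i (v - 1))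
    (h : InSeg p.1 (p.1.i, u) ∨ InSeg p.2 (p.2.i, v)) :
    ∃ m, Reduces n r V {p} m := by
  obtain ⟨⟨i, a, x⟩, ⟨i', b, y⟩⟩ := p
  obtain ⟨p1, p2, p3, p4, p5, p6, p7, p8, p9⟩ := hp
  simp only [InSeg] at *
  obtain ⟨a, rfl⟩ := Nat.exists_eq_add_of_le' p2
  obtain ⟨b, rfl⟩ := Nat.exists_eq_add_of_le' p5
  obtain ⟨u, rfl⟩ := Nat.exists_eq_add_of_le' hu
  obtain ⟨v, rfl⟩ := Nat.exists_eq_add_of_le' hv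
  simp only [Nat.add_sub_cancel] at *
  have rau := (hr i).le_iff_le (show a ≤ n i by omega) (show u ≤ n i by omega)
  have rux := (hr i).le_iff_le (show u + 1 ≤ n i by omega) (show x ≤ n i by omega)
  have rbv := (hr i').le_iff_le (show b ≤ n i' by omega) (show v ≤ n i' by omega)
  have rvy := (hr i').le_iff_le (show v + 1 ≤ n i' by omega) (show y ≤ n i' by omega)
  have rxu := (hr i).le_iff_le (show x ≤ n i by omega) (show u ≤ n i by omega)
  have rua := (hr i).le_iff_le (show u + 1 ≤ n i by omega) (show a ≤ n i by omega)
  by_cases hA : a + 1 ≤ u + 1 ∧ u + 1 ≤ x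
  · refine ⟨{(⟨i, a + 1, u⟩, ⟨i', b + 1, v⟩), (⟨i, u + 1 + 1, x⟩, ⟨i', v + 1 + 1, y⟩)},
      ?_, ?_, fun P hPV => ?_, fun P hPV => ?_⟩
    · intro p hp
      simp only [Multiset.insert_eq_cons, Multiset.mem_cons, Multiset.mem_singleton] at hp
      rcases hp with rfl | rfl <;> constructor <;> simp only [Nat.add_sub_cancel] <;> omega
    · simp only [Multiset.insert_eq_cons, Multiset.map_cons, Multiset.sum_cons,
        Multiset.map_singleton, Multiset.sum_singleton, weight]
      omega
    all_goals
      have := hP P hPV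
      simp only [Multiset.insert_eq_cons, Multiset.map_cons, Multiset.sum_cons,
        Multiset.map_singleton, Multiset.sum_singleton, excess, Nat.add_sub_cancel]
      omega
  have hB : b + 1 ≤ v + 1 ∧ v + 1 ≤ y := by omega
  by_cases hxu : x ≤ u
  · refine ⟨{(⟨i, a + 1, x⟩, ⟨i', b + 1, v⟩)}, ?_, ?_, fun P hPV => ?_, fun P hPV => ?_⟩
    · intro p hp
      rw [Multiset.mem_singleton] at hp
      subst hp
      constructor <;> simp only [Nat.add_sub_cancel] <;> omega
    · simp only [Multiset.map_singleton, Multiset.sum_singleton, weight]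
      omega
    all_goals
      have := (hV P hPV i').lt_iff_lt (show v ≤ n i' by omega) (show y ≤ n i' by omega)
      simp only [Multiset.map_singleton, Multiset.sum_singleton, excess, Nat.add_sub_cancel]
      omega
  · refine ⟨{(⟨i, a + 1, x⟩, ⟨i', v + 1 + 1, y⟩)}, ?_, ?_, fun P hPV => ?_, fun P hPV => ?_⟩
    · intro p hp
      rw [Multiset.mem_singleton] at hp
      subst hp
      constructor <;> simp only [Nat.add_sub_cancel] <;> omega
    · simp only [Multiset.map_singleton, Multiset.sum_singleton, weight]
      omega
    all_goals
      have := (hV P hPV i').lt_iff_lt (show b ≤ n i' by omega) (show v + 1 ≤ n i' by omega)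
      simp only [Multiset.map_singleton, Multiset.sum_singleton, excess, Nat.add_sub_cancel]
      omega

theorem Certificate.exists_irreducible {m : Multiset (Seg × Seg)} (h : Certificate n r V m) :
    ∃ m, Certificate n r V m ∧ ∀ c m₀ m', m = m₀ + c → ¬ Reduces n r V m₀ m' := by
  induction hw : (m.map weight).sum using Nat.strong_induction_on generalizing m with
  | _ w ih =>
    by_cases hm : ∃ c m₀ m', m = m₀ + c ∧ Reduces n r V m₀ m'
    · obtain ⟨c, m₀, m', rfl, hred⟩ := hm
      refine ih _ ?_ (h.reduce hred) rfl
      have := hred.weight_lt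
      simp only [Multiset.map_add, Multiset.sum_add] at hw ⊢
      omega
    · push Not at hm
      exact ⟨m, h, hm⟩

end Reductions

section Positions

variable {Y : Type*}

/-- The number of boundaries on each side. -/
def sideLength (U₁ U₂ : List Y) (i : ℕ) : ℕ :=
  if i = 1 ∨ i = 2 then (word U₁ U₂ i).length else 0

/-- The position of the boundary `(i, j)` for the length assignment `L`. -/
def position (U₁ U₂ : List Y) (L : Y → ℤ) (i j : ℕ) : ℤ :=
  (((word U₁ U₂ i).take j).map L).sum

theorem position_zero (U₁ U₂ : List Y) (L : Y → ℤ) (i : ℕ) : position U₁ U₂ L i 0 = 0 := by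
  simp [position]

theorem position_add_one {U₁ U₂ : List Y} {L : Y → ℤ} {i j : ℕ}
    (hj : j < (word U₁ U₂ i).length) :
    position U₁ U₂ L i (j + 1) = position U₁ U₂ L i j + L (word U₁ U₂ i)[j] := by
  rw [position, position, List.take_succ_eq_append_getElem hj, List.map_append, List.sum_append,
    List.map_singleton, List.sum_singleton]

theorem strictMonoOn_position {U₁ U₂ : List Y} {L : Y → ℤ}
    (hL : ∀ x ∈ U₁ ++ U₂, 0 < L x) (i : ℕ) :
    StrictMonoOn (position U₁ U₂ L i) (Set.Iic (sideLength U₁ U₂ i)) := by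
  refine strictMonoOn_of_lt_add_one Set.ordConnected_Iic fun j _ _ hj => ?_
  have hlt : j < (word U₁ U₂ i).length := by
    simp only [Set.mem_Iic, sideLength] at hj
    split_ifs at hj <;> omega
  rw [position_add_one hlt]
  have hmem : (word U₁ U₂ i)[j] ∈ U₁ ++ U₂ := by
    have := List.getElem_mem hlt
    rw [List.mem_append]
    unfold word at this ⊢
    split_ifs at this ⊢ <;> simp
  have := hL _ hmem
  omega

theorem natCast_prefixLen (U₁ U₂ : List Y) (L : Y → ℕ) (b : ℕ × ℕ) :
    (prefixLen U₁ U₂ L b : ℤ) = position U₁ U₂ (fun x => L x) b.1 b.2 := by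
  simp [prefixLen, position, List.map_map, Function.comp_def]

theorem natCast_segL (U₁ U₂ : List Y) (L : Y → ℕ) {s : Seg} (h : s.j ≤ s.k + 1) :
    (segL U₁ U₂ L s : ℤ) = position U₁ U₂ (fun x => L x) s.i s.k -
      position U₁ U₂ (fun x => L x) s.i (s.j - 1) := by
  have h1 : ((word U₁ U₂ s.i).take s.k).take (s.j - 1) = (word U₁ U₂ s.i).take (s.j - 1) := by
    rw [List.take_take, min_eq_left (by omega)]
  have h2 := List.take_append_drop (s.j - 1) ((word U₁ U₂ s.i).take s.k)
  rw [h1] at h2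
  have h3 := congrArg (fun l => (l.map fun x => (L x : ℤ)).sum) h2
  simp only [List.map_append, List.sum_append] at h3
  rw [position, position, ← h3, segL, segList, Nat.cast_list_sum, List.map_map]
  simp only [Function.comp_def, add_sub_cancel_left]

theorem exists_rank {U₁ U₂ : List Y} {lt : BRel} (hbo : BoundaryOrder U₁ U₂ lt) :
    ∃ r : ℕ → ℕ → ℤ, ∀ a b, EBoundary U₁ U₂ a → EBoundary U₁ U₂ b →
      (lt a b ↔ r a.1 a.2 < r b.1 b.2) := by
  have hfin : {a | EBoundary U₁ U₂ a}.Finite := by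
    refine (((Set.finite_Iic 2).prod (Set.finite_Iic (U₁.length + U₂.length)))).subset ?_
    rintro ⟨i, j⟩ ⟨hi, hj⟩
    simp only [Set.mem_prod, Set.mem_Iic, word] at *
    split_ifs at hj <;> omega
  refine ⟨fun i j => ({c | EBoundary U₁ U₂ c ∧ lt c (i, j)}.ncard : ℤ), fun a b ha hb => ?_⟩
  rw [Nat.cast_lt]
  constructor
  · intro hab
    refine Set.ncard_lt_ncard ⟨fun c hc => ⟨hc.1, hbo.trans c a b hc.1 ha hb hc.2 hab⟩, ?_⟩
      (hfin.subset fun c hc => hc.1)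
    exact fun h => hbo.irrefl a ha (h ⟨ha, hab⟩).2
  · intro h
    by_contra hab
    refine h.not_ge (Set.ncard_le_ncard (fun c hc => ⟨hc.1, ?_⟩) (hfin.subset fun c hc => hc.1))
    obtain ⟨hc, hcb⟩ := hc
    by_contra hca
    by_cases hac : lt a c
    · exact hab (hbo.trans a c b ha hc hb hac hcb)
    by_cases hba : lt b a
    · exact hca (hbo.trans c b a hc hb ha hcb hba)
    · exact (hbo.incomp_trans c a b hc ha hb ⟨hca, hac⟩ ⟨hab, hba⟩).1 hcb

theorem sum_map_eq_sum_mul [DecidableEq Y] (L : Y → ℤ) (s : Finset Y) (l : List Y)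
    (hl : ∀ x ∈ l, x ∈ s) :
    (l.map L).sum = ∑ x ∈ s, (l.map fun y => if y = x then (1 : ℤ) else 0).sum * L x := by
  induction l with
  | nil => simp
  | cons y l ih =>
    simp only [List.map_cons, List.sum_cons, add_mul, Finset.sum_add_distrib]
    rw [ih fun x hx => hl x (List.mem_cons_of_mem y hx)]
    simp [hl y List.mem_cons_self]

theorem excess_position_eq_sum [DecidableEq Y] (U₁ U₂ : List Y) (L : Y → ℤ) (p : Seg × Seg) :
    excess (position U₁ U₂ L) p = ∑ x ∈ (U₁ ++ U₂).toFinset,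
      excess (position U₁ U₂ fun y => if y = x then 1 else 0) p * L x := by
  have h : ∀ i j, position U₁ U₂ L i j = ∑ x ∈ (U₁ ++ U₂).toFinset,
      position U₁ U₂ (fun y => if y = x then 1 else 0) i j * L x := by
    intro i j
    refine sum_map_eq_sum_mul L _ _ fun x hx => ?_
    have := List.mem_of_mem_take hx
    rw [List.mem_toFinset, List.mem_append]
    unfold word at this
    split_ifs at this <;> simp [this]
  simp only [excess, h, sub_mul, Finset.sum_sub_distrib]

theorem finite_rankCover (U₁ U₂ : List Y) (r : ℕ → ℕ → ℤ) :
    {p | RankCover (sideLength U₁ U₂) r p}.Finite := by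
  set N := U₁.length + U₂.length
  have hT : ((fun t : ℕ × ℕ × ℕ => Seg.mk t.1 t.2.1 t.2.2) ''
      Set.Iic 2 ×ˢ Set.Iic (N + 1) ×ˢ Set.Iic N).Finite :=
    ((Set.finite_Iic _).prod ((Set.finite_Iic _).prod (Set.finite_Iic _))).image _
  have hN : ∀ i, sideLength U₁ U₂ i ≤ N := by
    intro i
    unfold sideLength word
    split_ifs <;> omega
  refine (hT.prod hT).subset ?_
  rintro ⟨A, B⟩ ⟨h1, h2, h3, h4, h5, h6, h7, -, -⟩
  have hA := hN A.i
  have hB := hN B.i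
  refine ⟨⟨(A.i, A.j, A.k), ?_, rfl⟩, ⟨(B.i, B.j, B.k), ?_, rfl⟩⟩ <;>
    simp only [Set.mem_prod, Set.mem_Iic] at * <;> omega

/-- An incoherent equation has a certificate of incoherence. -/
theorem exists_certificate [DecidableEq Y] {U₁ U₂ : List Y} {r : ℕ → ℕ → ℤ}
    (hr : ∀ i, StrictMonoOn (r i) (Set.Iic (sideLength U₁ U₂ i))) (hbot : r 1 0 = r 2 0)
    (hinc : ¬ ∃ L : Y → ℕ, (∀ x, 0 < L x) ∧ ∀ a b, Boundary U₁ U₂ a → Boundary U₁ U₂ b →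
      (r a.1 a.2 < r b.1 b.2 ↔ prefixLen U₁ U₂ L a < prefixLen U₁ U₂ L b)) :
    ∃ m, Certificate (sideLength U₁ U₂) r
      {P | ∃ L : Y → ℕ, (∀ x, 0 < L x) ∧ P = position U₁ U₂ (fun x => L x)} m := by
  set s := (U₁ ++ U₂).toFinset with hs
  set G : Set ((Y → ℤ) × ℤ) :=
    (fun x => (fun y => if y = x then 1 else 0, 1)) '' (s : Set Y) ∪
    (fun p => (fun x => excess (position U₁ U₂ fun y => if y = x then 1 else 0) p, excess r p)) ''
      {p | RankCover (sideLength U₁ U₂) r p} with hG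
  have hfin : G.Finite := (s.finite_toSet.image _).union ((finite_rankCover U₁ U₂ r).image _)
  have hnn : ∀ g ∈ G, 0 ≤ g.2 := by
    rintro _ (⟨x, -, rfl⟩ | ⟨p, hp, rfl⟩)
    · exact zero_le_one
    · have h1 := hp.left
      have h2 := hp.right
      simp only [excess]
      omega
  rcases exists_int_solution_or_refutation s G hfin hnn with ⟨L, hL⟩ | ⟨g, hg, hzero, hpos⟩
  · refine absurd ?_ hinc
    have hL1 : ∀ x ∈ s, 1 ≤ L x := fun x hx => by
      simpa [hx] using hL _ (Or.inl ⟨x, hx, rfl⟩)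
    have hL2 : ∀ p, RankCover (sideLength U₁ U₂) r p →
        excess r p ≤ excess (position U₁ U₂ L) p := fun p hp => by
      rw [excess_position_eq_sum]
      exact hL _ (Or.inr ⟨p, hp, rfl⟩)
    have hmono := strictMonoOn_position (U₁ := U₁) (U₂ := U₂) (L := L)
      fun x hx => hL1 x (List.mem_toFinset.2 hx)
    have key : ∀ a b, Boundary U₁ U₂ a → Boundary U₁ U₂ b → r a.1 a.2 ≤ r b.1 b.2 →
        position U₁ U₂ L a.1 a.2 ≤ position U₁ U₂ L b.1 b.2 ∧
        (r a.1 a.2 < r b.1 b.2 → position U₁ U₂ L a.1 a.2 < position U₁ U₂ L b.1 b.2) := by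
      rintro ⟨i, j⟩ ⟨i', j'⟩ ⟨hi, hj1, hj2⟩ ⟨hi', hj1', hj2'⟩ hab
      simp only at *
      have hj : j ≤ sideLength U₁ U₂ i := by simpa [sideLength, hi] using hj2
      have hj' : j' ≤ sideLength U₁ U₂ i' := by simpa [sideLength, hi'] using hj2'
      by_cases hii : i = i'
      · subst hii
        rw [(hr i).le_iff_le hj hj'] at hab
        rw [(hr i).lt_iff_lt hj hj', (hmono i).lt_iff_lt hj hj', (hmono i).le_iff_le hj hj']
        exact ⟨hab, id⟩
      · have h0 : r i 0 = r i' 0 := by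
          rcases hi with rfl | rfl <;> rcases hi' with rfl | rfl <;> omega
        have := hL2 (⟨i, 1, j⟩, ⟨i', 1, j'⟩) (by constructor <;> simp only [Nat.sub_self] <;> omega)
        simp only [excess, Nat.sub_self, position_zero] at this
        omega
    have hpos : ∀ i j, position U₁ U₂ (fun x => ((if x ∈ s then (L x).toNat else 1 : ℕ) : ℤ)) i j =
        position U₁ U₂ L i j := by
      intro i j
      refine congrArg List.sum (List.map_congr_left fun x hx => ?_)
      have hx' : x ∈ s := by
        have := List.mem_of_mem_take hx
        rw [hs, List.mem_toFinset, List.mem_append]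
        unfold word at this
        split_ifs at this <;> simp [this]
      have := hL1 x hx'
      simp only [hx', if_true]
      omega
    refine ⟨fun x => if x ∈ s then (L x).toNat else 1, fun x => ?_, fun a b ha hb => ?_⟩
    · dsimp only
      split_ifs with hx
      · have := hL1 x hx
        omega
      · exact one_pos
    · rw [← Nat.cast_lt (α := ℤ), natCast_prefixLen, natCast_prefixLen, hpos, hpos]
      have h1 := key a b ha hb
      have h2 := key b a hb ha
      omega
  · have hsum : ∀ g ∈ AddSubmonoid.closure G, ∃ (m : Multiset (Seg × Seg)) (u : Y → ℕ),
        (∀ p ∈ m, RankCover (sideLength U₁ U₂) r p) ∧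
        (∀ x ∈ s, g.1 x = u x +
          (m.map (excess (position U₁ U₂ fun y => if y = x then 1 else 0))).sum) ∧
        g.2 = ∑ x ∈ s, (u x : ℤ) + (m.map (excess r)).sum := by
      intro g hg
      induction hg using AddSubmonoid.closure_induction with
      | mem g hg =>
        rcases hg with ⟨x, hx, rfl⟩ | ⟨p, hp, rfl⟩
        · refine ⟨0, fun y => if y = x then 1 else 0, by simp, by simp, ?_⟩
          simpa using hx
        · exact ⟨{p}, 0, by simpa using hp, by simp, by simp⟩
      | zero => exact ⟨0, 0, by simp, by simp, by simp⟩
      | add g g' _ _ h h' =>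
        obtain ⟨m, u, h1, h2, h3⟩ := h
        obtain ⟨m', u', h1', h2', h3'⟩ := h'
        refine ⟨m + m', u + u', fun p hp => (Multiset.mem_add.1 hp).elim (h1 p) (h1' p),
          fun x hx => ?_, ?_⟩
        · simp only [Prod.fst_add, Pi.add_apply, h2 x hx, h2' x hx, Multiset.map_add,
            Multiset.sum_add, Nat.cast_add]
          ring
        · simp only [Prod.snd_add, h3, h3', Pi.add_apply, Multiset.map_add, Multiset.sum_add,
            Nat.cast_add, Finset.sum_add_distrib]
          ring
    obtain ⟨m, u, hm, hu, ht⟩ := hsum g hg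
    have hexc : ∀ L : Y → ℤ, (m.map (excess (position U₁ U₂ L))).sum =
        -∑ x ∈ s, u x * L x := by
      intro L
      rw [Multiset.map_congr rfl fun p _ => excess_position_eq_sum U₁ U₂ L p,
        Multiset.sum_map_sum, ← Finset.sum_neg_distrib]
      refine Finset.sum_congr rfl fun x hx => ?_
      have := hu x hx
      rw [hzero x hx] at this
      rw [Multiset.sum_map_mul_right, ← neg_mul]
      congr 1
      omega
    refine ⟨m, hm, ?_, ?_⟩
    · rintro _ ⟨L, -, rfl⟩
      rw [hexc]
      exact neg_nonpos.2 (Finset.sum_nonneg fun x _ => by positivity)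
    · rintro _ ⟨L, hL, rfl⟩
      rw [hexc]
      have : ∑ x ∈ s, (u x : ℤ) ≤ ∑ x ∈ s, (u x : ℤ) * L x :=
        Finset.sum_le_sum fun x _ => le_mul_of_one_le_right (by positivity) (by exact_mod_cast hL x)
      omega

end Positions

/-- **Lemma.** Every incoherent extended word equation has an incoherent core in
which no cover impinges on another and every cover is twin-free. -/
theorem exists_twin_free_incoherent_core (U₁ U₂ : List X) (lt : BRel)
    (hbo : BoundaryOrder U₁ U₂ lt) (hinc : ¬ Coherent U₁ U₂ lt) :
    ∃ C : Set (Seg × Seg), IncoherentCore U₁ U₂ lt C ∧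
      (∀ p ∈ C, ∀ q ∈ C, p ≠ q → ¬ Impinges p q) ∧
      ∀ p ∈ C, TwinFree U₁ U₂ lt p := by
  obtain ⟨r₀, hr₀⟩ := exists_rank hbo
  set n := sideLength U₁ U₂ with hn
  have hside : ∀ i, i = 1 ∨ i = 2 → n i = (word U₁ U₂ i).length := fun i hi => by
    simp [hn, sideLength, hi]
  have hr : ∀ i, StrictMonoOn (r₀ i) (Set.Iic (n i)) := by
    intro i
    refine strictMonoOn_of_lt_add_one Set.ordConnected_Iic fun j _ _ hj => ?_
    rw [Set.mem_Iic] at hj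
    have hi : i = 1 ∨ i = 2 := by
      by_contra h
      simp [hn, sideLength, h] at hj
    rw [hside i hi] at hj
    exact (hr₀ (i, j) (i, j + 1) ⟨hi, by simp only; omega⟩ ⟨hi, hj⟩).1 (hbo.succ i j ⟨hi, hj⟩)
  set V : Set (ℕ → ℕ → ℤ) :=
    {P | ∃ L : X → ℕ, (∀ x, 0 < L x) ∧ P = position U₁ U₂ (fun x => L x)} with hVdef
  have hV : ∀ P ∈ V, ∀ i, StrictMonoOn (P i) (Set.Iic (n i)) := by
    rintro _ ⟨L, hL, rfl⟩ i
    exact strictMonoOn_position (fun x _ => by exact_mod_cast hL x) i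
  have hincomp : ∀ a b, EBoundary U₁ U₂ a → EBoundary U₁ U₂ b →
      (Incomp lt a b ↔ r₀ a.1 a.2 = r₀ b.1 b.2) := fun a b ha hb => by
    rw [Incomp, hr₀ a b ha hb, hr₀ b a hb ha]
    omega
  have hle : ∀ a b, EBoundary U₁ U₂ a → EBoundary U₁ U₂ b →
      (LeS lt a b ↔ r₀ a.1 a.2 ≤ r₀ b.1 b.2) := fun a b ha hb => by
    rw [LeS, hincomp a b ha hb, hr₀ a b ha hb]
    omega
  have hbot : r₀ 1 0 = r₀ 2 0 :=
    (hincomp (1, 0) (2, 0) ⟨Or.inl rfl, Nat.zero_le _⟩ ⟨Or.inr rfl, Nat.zero_le _⟩).1 hbo.bot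
  obtain ⟨m₀, hm₀⟩ := exists_certificate hr hbot (fun ⟨L, hL, h⟩ => hinc ⟨L, hL, fun a b ha hb => by
    rw [hr₀ a b ⟨ha.1, ha.2.2⟩ ⟨hb.1, hb.2.2⟩]
    exact h a b ha hb⟩)
  obtain ⟨m, hm, hirr⟩ := hm₀.exists_irreducible
  have hcover : ∀ p, RankCover n r₀ p → IsCover U₁ U₂ lt p.1 p.2 ∧
      (0 < excess r₀ p → IsStrictCover U₁ U₂ lt p.1 p.2) := by
    intro p hp
    obtain ⟨h1, h2, h3, h4, h5, h6, h7, h8, h9⟩ := hp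
    have hA : p.1.i = 1 ∨ p.1.i = 2 := by omega
    have hB : p.2.i = 1 ∨ p.2.i = 2 := by omega
    rw [hside _ hA] at h4
    rw [hside _ hB] at h7
    have eAl : EBoundary U₁ U₂ (p.1.i, p.1.j - 1) := ⟨hA, by simp only; omega⟩
    have eAr : EBoundary U₁ U₂ (p.1.i, p.1.k) := ⟨hA, h4⟩
    have eBl : EBoundary U₁ U₂ (p.2.i, p.2.j - 1) := ⟨hB, by simp only; omega⟩
    have eBr : EBoundary U₁ U₂ (p.2.i, p.2.k) := ⟨hB, h7⟩
    have hc : IsCover U₁ U₂ lt p.1 p.2 := ⟨⟨hA, h2, h3, h4⟩, ⟨hB, h5, h6, h7⟩, by omega,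
      (hle _ _ eBl eAl).2 h8, (hle _ _ eAr eBr).2 h9⟩
    refine ⟨hc, fun hpos => ⟨hc, ?_⟩⟩
    rw [hr₀ _ _ eBl eAl, hr₀ _ _ eAr eBr]
    simp only [excess] at hpos ⊢
    omega
  have htwin : ∀ a b, Twins U₁ U₂ lt a b → a.1 ≠ b.1 ∧ 1 ≤ a.2 ∧ a.2 ≤ n a.1 ∧ 1 ≤ b.2 ∧
      b.2 ≤ n b.1 ∧ r₀ a.1 (a.2 - 1) = r₀ b.1 (b.2 - 1) ∧ r₀ a.1 a.2 = r₀ b.1 b.2 ∧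
      ∀ P ∈ V, P a.1 a.2 - P a.1 (a.2 - 1) = P b.1 b.2 - P b.1 (b.2 - 1) := by
    rintro ⟨i, j⟩ ⟨i', j'⟩ ⟨⟨hi, hj, hjn⟩, ⟨hi', hj', hjn'⟩, hlet, hne, heq, hpred⟩
    simp only at *
    rw [hincomp (i, j) (i', j') ⟨hi, hjn⟩ ⟨hi', hjn'⟩] at heq
    rw [hincomp (i, j - 1) (i', j' - 1) ⟨hi, by simp only; omega⟩
      ⟨hi', by simp only; omega⟩] at hpred
    refine ⟨?_, hj, by rwa [hside i hi], hj', by rwa [hside i' hi'], hpred, heq, ?_⟩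
    · rintro rfl
      rw [← hside i hi] at hjn hjn'
      exact hne (Prod.ext rfl ((hr i).injOn hjn hjn' heq))
    · rintro _ ⟨L, -, rfl⟩
      obtain ⟨j, rfl⟩ := Nat.exists_eq_add_of_le' hj
      obtain ⟨j', rfl⟩ := Nat.exists_eq_add_of_le' hj'
      simp only [letter, Nat.add_sub_cancel] at hlet ⊢
      rw [List.getElem?_eq_getElem hjn, List.getElem?_eq_getElem hjn', Option.some_inj] at hlet
      rw [position_add_one hjn, position_add_one hjn', hlet]
      ring
  have htf : ∀ p ∈ m, ∀ a b, Twins U₁ U₂ lt a b → ¬ (InSeg p.1 a ∨ InSeg p.2 a) := by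
    intro p hp a b hab h
    obtain ⟨t1, t2, t3, t4, t5, t6, t7, t8⟩ := htwin a b hab
    have hb : b.1 = 1 ∨ b.1 = 2 := hab.2.1.1
    have hc := hm.cover p hp
    have hside := hc.side
    obtain ⟨c, hc'⟩ := Multiset.exists_cons_of_mem hp
    rw [← Multiset.singleton_add] at hc'
    rcases h with h | h
    · have e1 : a.1 = p.1.i := h.1
      have e2 : b.1 = p.2.i := by omega
      obtain ⟨m', hm'⟩ := exists_reduces_of_twin hr hV hc (u := a.2) (v := b.2) t2 (e1 ▸ t3) t4
        (e2 ▸ t5) (e1 ▸ e2 ▸ t6) (e1 ▸ e2 ▸ t7) (e1 ▸ e2 ▸ t8) (Or.inl (e1 ▸ h))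
      exact hirr _ _ _ hc' hm'
    · have e1 : a.1 = p.2.i := h.1
      have e2 : b.1 = p.1.i := by omega
      obtain ⟨m', hm'⟩ := exists_reduces_of_twin hr hV hc (u := b.2) (v := a.2) t4 (e2 ▸ t5) t2
        (e1 ▸ t3) (e1 ▸ e2 ▸ t6.symm) (e1 ▸ e2 ▸ t7.symm)
        (e1 ▸ e2 ▸ fun P hP => (t8 P hP).symm) (Or.inr (e1 ▸ h))
      exact hirr _ _ _ hc' hm'
  refine ⟨{p | p ∈ m}, ⟨fun p hp => (hcover p (hm.cover p hp)).1, ?_⟩, fun p hp q hq hpq himp => ?_,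
    fun p hp => ⟨fun a ha ⟨b, hb⟩ => htf p hp a b hb (Or.inl ha),
      fun a ha ⟨b, hb⟩ => htf p hp a b hb (Or.inr ha)⟩⟩
  · rintro ⟨L, hL, hle, hlt⟩
    have hPV : position U₁ U₂ (fun x => L x) ∈ V := ⟨L, hL, rfl⟩
    have hexc : ∀ p ∈ m, excess (position U₁ U₂ fun x => L x) p =
        segL U₁ U₂ L p.2 - segL U₁ U₂ L p.1 := fun p hp => by
      rw [natCast_segL U₁ U₂ L (hm.cover p hp).fst_le, natCast_segL U₁ U₂ L (hm.cover p hp).snd_le,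
        excess]
    have hnn : ∀ p ∈ m, 0 ≤ excess (position U₁ U₂ fun x => L x) p := fun p hp => by
      have := hle p hp
      rw [hexc p hp]
      omega
    have hsum : 0 ≤ (m.map (excess (position U₁ U₂ fun x => L x))).sum :=
      Multiset.sum_nonneg fun x hx => by
        obtain ⟨p, hp, rfl⟩ := Multiset.mem_map.1 hx
        exact hnn p hp
    have hpos := (hm.strict _ hPV).resolve_right hsum.not_gt
    obtain ⟨p, hp, hp0⟩ : ∃ p ∈ m, 0 < excess r₀ p := by
      by_contra! h
      refine hpos.not_ge ((Multiset.sum_le_card_nsmul _ 0 fun x hx => ?_).trans_eq (nsmul_zero _))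
      obtain ⟨p, hp, rfl⟩ := Multiset.mem_map.1 hx
      exact h p hp
    have h1 := hlt p hp ((hcover p (hm.cover p hp)).2 hp0)
    have h2 := hm.nonpos _ hPV
    have h3 := Multiset.single_le_sum (fun x hx => by
        obtain ⟨p, hp, rfl⟩ := Multiset.mem_map.1 hx
        exact hnn p hp) _
      (Multiset.mem_map_of_mem (excess (position U₁ U₂ fun x => L x)) hp)
    rw [hexc p hp] at h3
    omega
  · obtain ⟨c, rfl⟩ := Multiset.exists_cons_of_mem hp
    obtain ⟨d, rfl⟩ := Multiset.exists_cons_of_mem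
      ((Multiset.mem_cons.1 hq).resolve_left (Ne.symm hpq))
    obtain ⟨m', hm'⟩ := exists_reduces_of_impinges hr hV (hm.cover p hp) (hm.cover q hq) himp
    refine hirr d _ m' ?_ hm'
    rw [Multiset.insert_eq_cons, Multiset.cons_add, Multiset.singleton_add]

end ExtWordEq
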